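/- Assume a2 ≥ 2 and let μ_R = μ_{r_{a2-1}} ∘ ⋯ ∘ μ_{r_2} ∘ μ_{r_1} (applying μ_{r_1} first). Then μ_R(B(Q)) = B(Q'), where Q' is the quiver on the same vertex set with arrows s_1 → s_2 → ⋯ → s_{a1-1} → r_{a2}, r_{a2} → r_{a2-1}, r_{a2-1} → r_0, r_0 → t_1 → ⋯ → t_{a1-1}, and r_1 → r_2 → ⋯ → r_{a2-2} → r_{a2-1}. In particular Q' is acyclic and its underlying graph is a tree with three branches emanating from the vertex r_{a2-1}, of sizes a1, a1 and a2−2 (the type T_{a1+1, a1+1, a2-1}). -/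

import Mathlib

inductive V (a1 a2 : ℕ) : Type where
  | r : Fin (a2 + 1) → V a1 a2
  | s : Fin (a1 - 1) → V a1 a2
  | t : Fin (a1 - 1) → V a1 a2
deriving DecidableEq

/-- The arrows of the quiver `Q = Q[a1, a2]`.  The vertex `V.s j` denotes `s_{j+1}` and
`V.t j` denotes `t_{j+1}`. -/
def Arrow (a1 a2 : ℕ) : V a1 a2 → V a1 a2 → Prop
  | .r i, .r j => ((i : ℕ) + 1 = (j : ℕ)) ∨ ((i : ℕ) = a2 ∧ (j : ℕ) = 0)
  | .s i, .s j => (i : ℕ) + 1 = (j : ℕ)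
  | .s i, .r j => (i : ℕ) = a1 - 2 ∧ (j : ℕ) = a2
  | .r i, .t j => (i : ℕ) = 0 ∧ (j : ℕ) = 0
  | .t i, .t j => (i : ℕ) + 1 = (j : ℕ)
  | _, _ => False

open Classical in
/-- The exchange matrix `B(Q)` of a quiver given by an arrow relation (at most one arrow
between any two vertices): `B x y = #(arrows x → y) - #(arrows y → x)`. -/
noncomputable def BmatOf {a1 a2 : ℕ} (A : V a1 a2 → V a1 a2 → Prop) :
    V a1 a2 → V a1 a2 → ℤ :=
  fun x y => (if A x y then 1 else 0) - (if A y x then 1 else 0)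

noncomputable def Bmat (a1 a2 : ℕ) : V a1 a2 → V a1 a2 → ℤ := BmatOf (Arrow a1 a2)

/-- Fomin–Zelevinsky matrix mutation at the vertex `p`. -/
noncomputable def mutB {a1 a2 : ℕ} (p : V a1 a2) (B : V a1 a2 → V a1 a2 → ℤ) :
    V a1 a2 → V a1 a2 → ℤ :=
  fun x y =>
    if x = p ∨ y = p then - B x y
    else B x y + (|B x p| * B p y + B x p * |B p y|) / 2

/-- Apply a sequence of mutations, the head of the list first. -/
noncomputable def mutSeq {a1 a2 : ℕ} (l : List (V a1 a2)) (B : V a1 a2 → V a1 a2 → ℤ) :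
    V a1 a2 → V a1 a2 → ℤ :=
  l.foldl (fun B p => mutB p B) B

/-- The vertex `r_n` (indices taken mod `a2 + 1`). -/
def rv (a1 a2 : ℕ) (n : ℕ) : V a1 a2 := .r ⟨n % (a2 + 1), Nat.mod_lt n (Nat.succ_pos a2)⟩

/-- The vertex `s_n` for `1 ≤ n ≤ a1 - 1`, with the convention `s_{a1} := r_{a2}`. -/
def sv (a1 a2 : ℕ) (n : ℕ) : V a1 a2 :=
  if h : 1 ≤ n ∧ n ≤ a1 - 1 then .s ⟨n - 1, by omega⟩ else .r (Fin.last a2)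

/-- The vertex `t_n` for `1 ≤ n ≤ a1 - 1`, with the convention `t_0 := r_0`. -/
def tv (a1 a2 : ℕ) (n : ℕ) : V a1 a2 :=
  if h : 1 ≤ n ∧ n ≤ a1 - 1 then .t ⟨n - 1, by omega⟩ else .r 0

/-- The mutation sequence `μ_R = μ_{r_{a2-1}} ∘ ⋯ ∘ μ_{r_2} ∘ μ_{r_1}` (as a list, applied
head first). -/
def Rlist (a1 a2 : ℕ) : List (V a1 a2) :=
  (List.range (a2 - 1)).map (fun m => rv a1 a2 (m + 1))

/-- The mutation sequence `μ_S = C_{a1} ∘ ⋯ ∘ C_2 ∘ C_1` where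
`C_m = μ_{s_1} ∘ μ_{s_2} ∘ ⋯ ∘ μ_{s_m}` (applied `μ_{s_m}` first) and `s_{a1} := r_{a2}`. -/
def Slist (a1 a2 : ℕ) : List (V a1 a2) :=
  ((List.range a1).map (fun m => (List.range (m + 1)).map
      (fun d => sv a1 a2 (m + 1 - d)))).flatten

/-- The mutation sequence `μ_T = D_{a1} ∘ ⋯ ∘ D_2 ∘ D_1` where
`D_m = μ_{t_{a1-1}} ∘ μ_{t_{a1-2}} ∘ ⋯ ∘ μ_{t_{a1-m}}` (applied `μ_{t_{a1-m}}` first) and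
`t_0 := r_0`. -/
def Tlist (a1 a2 : ℕ) : List (V a1 a2) :=
  ((List.range a1).map (fun m => (List.range (m + 1)).map
      (fun d => tv a1 a2 (a1 - (m + 1) + d)))).flatten

/-- The arrows of the quiver `Q'`: `s_1 → ⋯ → s_{a1-1} → r_{a2}`, `r_{a2} → r_{a2-1}`,
`r_{a2-1} → r_0`, `r_0 → t_1 → ⋯ → t_{a1-1}` and `r_1 → r_2 → ⋯ → r_{a2-2} → r_{a2-1}`. -/
def Arrow' (a1 a2 : ℕ) : V a1 a2 → V a1 a2 → Prop
  | .r i, .r j => ((i : ℕ) = a2 ∧ (j : ℕ) = a2 - 1) ∨ ((i : ℕ) = a2 - 1 ∧ (j : ℕ) = 0) ∨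
      (1 ≤ (i : ℕ) ∧ (i : ℕ) + 1 = (j : ℕ) ∧ (j : ℕ) ≤ a2 - 1)
  | .s i, .s j => (i : ℕ) + 1 = (j : ℕ)
  | .s i, .r j => (i : ℕ) = a1 - 2 ∧ (j : ℕ) = a2
  | .r i, .t j => (i : ℕ) = 0 ∧ (j : ℕ) = 0
  | .t i, .t j => (i : ℕ) + 1 = (j : ℕ)
  | _, _ => False

/-- Arrows among the `r`-vertices after `k` mutations (indices as naturals). -/
def MidR (a2 k i j : ℕ) : Prop :=
  (1 ≤ k ∧ i = k ∧ j = 0) ∨ (1 ≤ i ∧ i < k ∧ j = i + 1) ∨ (1 ≤ k ∧ i = k + 1 ∧ j = k) ∨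
    (i = 0 ∧ j = k + 1) ∨ (k + 1 ≤ i ∧ j = i + 1) ∨ (i = a2 ∧ j = 0)

def Mid (a1 a2 k : ℕ) : V a1 a2 → V a1 a2 → Prop
  | .r i, .r j => MidR a2 k i j
  | x, y => Arrow a1 a2 x y

open Classical in
noncomputable def bR (a2 k i j : ℕ) : ℤ :=
  (if MidR a2 k i j then 1 else 0) - (if MidR a2 k j i then 1 else 0)

lemma bR_cases (a2 k i j : ℕ) : (MidR a2 k i j ∧ MidR a2 k j i ∧ bR a2 k i j = 0) ∨
    (MidR a2 k i j ∧ ¬ MidR a2 k j i ∧ bR a2 k i j = 1) ∨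
    (¬ MidR a2 k i j ∧ MidR a2 k j i ∧ bR a2 k i j = -1) ∨
    (¬ MidR a2 k i j ∧ ¬ MidR a2 k j i ∧ bR a2 k i j = 0) := by
  unfold bR
  by_cases h1 : MidR a2 k i j <;> by_cases h2 : MidR a2 k j i <;> simp [h1, h2]

lemma bR_col (a2 k i : ℕ) (h : k + 1 < a2) (hi : i ≤ a2) :
    bR a2 k i (k+1) = if i = 0 then 1 else if i = k then -1 else if i = k + 2 then -1 else 0 := by
  rcases bR_cases a2 k i (k+1) with ⟨h1, h2, h3⟩ | ⟨h1, h2, h3⟩ | ⟨h1, h2, h3⟩ | ⟨h1, h2, h3⟩ <;>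
  rw [h3] <;> unfold MidR at h1 h2 <;> clear h3 <;> split_ifs <;> grind

lemma bR_col' (a2 k i : ℕ) (h : k + 1 < a2) (hi : i ≤ a2) :
    bR a2 (k+1) i (k+1) =
      if i = 0 then -1 else if i = k then 1 else if i = k + 2 then 1 else 0 := by
  rcases bR_cases a2 (k+1) i (k+1) with
    ⟨h1, h2, h3⟩ | ⟨h1, h2, h3⟩ | ⟨h1, h2, h3⟩ | ⟨h1, h2, h3⟩ <;>
  rw [h3] <;> unfold MidR at h1 h2 <;> clear h3 <;> split_ifs <;> grind

lemma bR_swap (a2 k i j : ℕ) : bR a2 k i j = - bR a2 k j i := by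
  unfold bR; ring

lemma bR_neg (a2 k i j : ℕ) (h : k + 1 < a2) (hi : i ≤ a2) (hj : j ≤ a2)
    (hp : i = k + 1 ∨ j = k + 1) : bR a2 (k+1) i j = - bR a2 k i j := by
  rcases hp with rfl | rfl
  · rw [bR_swap a2 (k+1), bR_swap a2 k, bR_col _ _ _ h hj, bR_col' _ _ _ h hj]
    split_ifs <;> rfl
  · rw [bR_col _ _ _ h hi, bR_col' _ _ _ h hi]
    split_ifs <;> rfl

lemma bR_same (a2 k i j : ℕ) (h : k + 1 < a2) (hi : i ≤ a2) (hj : j ≤ a2)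
    (hip : i ≠ k + 1) (hjp : j ≠ k + 1) (h1 : ¬ (i = 0 ∧ (j = k ∨ j = k + 2)))
    (h2 : ¬ (j = 0 ∧ (i = k ∨ i = k + 2))) : bR a2 (k+1) i j = bR a2 k i j := by
  have e : ∀ i j : ℕ, i ≤ a2 → j ≤ a2 → i ≠ k + 1 → j ≠ k + 1 →
      ¬ (i = 0 ∧ (j = k ∨ j = k + 2)) → ¬ (j = 0 ∧ (i = k ∨ i = k + 2)) →
      (MidR a2 (k+1) i j ↔ MidR a2 k i j) := by
    intro i j _ _ _ _ _ _
    unfold MidR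
    constructor <;> intro hh <;> omega
  unfold bR
  rw [e i j hi hj hip hjp h1 h2, e j i hj hi hjp hip h2 h1]

lemma bR_zk (a2 k : ℕ) (h : k + 1 < a2) (hk : 1 ≤ k) :
    bR a2 (k+1) 0 k = 0 ∧ bR a2 k 0 k = -1 := by
  constructor
  · rcases bR_cases a2 (k+1) 0 k with
      ⟨h1, h2, h3⟩ | ⟨h1, h2, h3⟩ | ⟨h1, h2, h3⟩ | ⟨h1, h2, h3⟩ <;>
    rw [h3] <;> unfold MidR at h1 h2 <;> clear h3 <;> omega
  · rcases bR_cases a2 k 0 k with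
      ⟨h1, h2, h3⟩ | ⟨h1, h2, h3⟩ | ⟨h1, h2, h3⟩ | ⟨h1, h2, h3⟩ <;>
    rw [h3] <;> unfold MidR at h1 h2 <;> clear h3 <;> omega

lemma bR_zk2 (a2 k : ℕ) (h : k + 1 < a2) :
    bR a2 (k+1) 0 (k+2) = bR a2 k 0 (k+2) + 1 := by
  have e1 : MidR a2 (k+1) 0 (k+2) := by unfold MidR; omega
  have e2 : ¬ MidR a2 k 0 (k+2) := by unfold MidR; omega
  have e3 : MidR a2 (k+1) (k+2) 0 ↔ MidR a2 k (k+2) 0 := by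
    unfold MidR
    constructor <;> intro hh <;> omega
  unfold bR
  rw [e3]
  simp only [e1, e2, if_true, if_false]
  ring

lemma bR_step (a2 k i j : ℕ) (h : k + 1 < a2) (hi : i ≤ a2) (hj : j ≤ a2)
    (hip : i ≠ k + 1) (hjp : j ≠ k + 1) :
    bR a2 (k+1) i j = bR a2 k i j +
      (|bR a2 k i (k+1)| * bR a2 k (k+1) j + bR a2 k i (k+1) * |bR a2 k (k+1) j|) / 2 := by
  rw [bR_swap a2 k (k+1) j, bR_col _ _ _ h hi, bR_col _ _ _ h hj]
  by_cases h1 : i = 0 ∧ j ≠ 0 ∧ (j = k ∨ j = k + 2)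
  · obtain ⟨rfl, h0, rfl | rfl⟩ := h1
    · have := bR_zk a2 j h (by omega)
      simp [this.1, this.2, h0]
    · rw [bR_zk2 a2 k h]
      simp
  by_cases h2 : j = 0 ∧ i ≠ 0 ∧ (i = k ∨ i = k + 2)
  · obtain ⟨rfl, h0, rfl | rfl⟩ := h2
    · have := bR_zk a2 i h (by omega)
      rw [bR_swap a2 (i+1), bR_swap a2 i]
      simp [this.1, this.2, h0]
    · rw [bR_swap a2 (k+1), bR_swap a2 k, bR_zk2 a2 k h]
      simp
      ring
  by_cases h3 : i = 0 ∧ j = 0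
  · obtain ⟨rfl, rfl⟩ := h3
    simp [bR]
  rw [bR_same a2 k i j h hi hj hip hjp (by omega) (by omega)]
  split_ifs <;> first | (exfalso; omega) | simp

lemma B_rr (a1 a2 k : ℕ) (i j : Fin (a2+1)) :
    BmatOf (Mid a1 a2 k) (.r i) (.r j) = bR a2 k i j := rfl

lemma Mid_step (a1 a2 k : ℕ) (h : k + 1 < a2) :
    mutB (rv a1 a2 (k+1)) (BmatOf (Mid a1 a2 k)) = BmatOf (Mid a1 a2 (k+1)) := by
  have hm : (k+1) % (a2+1) = k+1 := Nat.mod_eq_of_lt (by omega)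
  have hs : ∀ j, BmatOf (Mid a1 a2 k) (rv a1 a2 (k+1)) (.s j) = 0 := by
    intro j; simp [BmatOf, rv, Mid, Arrow, hm]; omega
  have hs' : ∀ j, BmatOf (Mid a1 a2 k) (.s j) (rv a1 a2 (k+1)) = 0 := by
    intro j; simp [BmatOf, rv, Mid, Arrow, hm]; omega
  have ht : ∀ j, BmatOf (Mid a1 a2 k) (rv a1 a2 (k+1)) (.t j) = 0 := by
    intro j; simp [BmatOf, rv, Mid, Arrow, hm]
  have ht' : ∀ j, BmatOf (Mid a1 a2 k) (.t j) (rv a1 a2 (k+1)) = 0 := by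
    intro j; simp [BmatOf, rv, Mid, Arrow, hm]
  funext x y
  have key : ∀ x y, (BmatOf (Mid a1 a2 k) x (rv a1 a2 (k+1)) = 0 ∨
      BmatOf (Mid a1 a2 k) (rv a1 a2 (k+1)) y = 0) →
      (x = rv a1 a2 (k+1) ∨ y = rv a1 a2 (k+1) → BmatOf (Mid a1 a2 k) x y = 0) →
      mutB (rv a1 a2 (k+1)) (BmatOf (Mid a1 a2 k)) x y = BmatOf (Mid a1 a2 k) x y := by
    intro x y h1 h2
    unfold mutB
    split_ifs with hc
    · simp [h2 hc]
    · rcases h1 with h1 | h1 <;> simp [h1]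
  rcases x with i | i | i <;> rcases y with j | j | j
  · have hv : ∀ i : Fin (a2+1), (V.r i : V a1 a2) = rv a1 a2 (k+1) ↔ (i:ℕ) = k+1 := by
      intro i; simp [rv, Fin.ext_iff, hm]
    unfold mutB
    simp only [hv]
    have e : rv a1 a2 (k+1) = .r ⟨k+1, by omega⟩ := by simp [rv, hm]
    rw [e]
    simp only [B_rr]
    split_ifs with hc
    · exact (bR_neg a2 k i j h (by omega) (by omega) hc).symm
    · push Not at hc
      exact (bR_step a2 k i j h (by omega) (by omega) hc.1 hc.2).symm
  all_goals
    rw [key]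
    · rfl
    · simp only [hs, hs', ht, ht', true_or, or_true]
    · rintro (hc | hc) <;> first | (rw [hc]; simp only [hs, hs', ht, ht']) | (simp [rv] at hc)

lemma Mid_zero (a1 a2 : ℕ) : BmatOf (Mid a1 a2 0) = Bmat a1 a2 := by
  unfold Bmat
  congr 1
  funext x y
  rcases x with i | i | i <;> rcases y with j | j | j <;> try rfl
  simp only [Mid, MidR, Arrow, eq_iff_iff]
  omega

lemma MidR_last (a1 a2 : ℕ) (ha2 : 2 ≤ a2) (i j : Fin (a2+1)) :
    MidR a2 (a2 - 1) i j ↔ (Arrow' a1 a2 (.r i) (.r j) ∨ ((i:ℕ) = 0 ∧ (j:ℕ) = a2) ∨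
      ((i:ℕ) = a2 ∧ (j:ℕ) = 0)) := by
  have e1 := i.2
  have e2 := j.2
  simp only [MidR, Arrow']
  generalize (i:ℕ) = i at *
  generalize (j:ℕ) = j at *
  obtain ⟨m, rfl⟩ : ∃ m, a2 = m + 1 := ⟨a2 - 1, by omega⟩
  simp only [Nat.add_sub_cancel]
  constructor <;> intro hh
  · rcases hh with hh | hh | hh | hh | hh | hh <;> omega
  · rcases hh with (hh | hh | hh) | hh | hh <;> omega

lemma Mid_last (a1 a2 : ℕ) (ha2 : 2 ≤ a2) :
    BmatOf (Mid a1 a2 (a2 - 1)) = BmatOf (Arrow' a1 a2) := by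
  funext x y
  rcases x with i | i | i <;> rcases y with j | j | j <;> try rfl
  rw [B_rr]
  unfold bR BmatOf
  have m1 := MidR_last a1 a2 ha2 i j
  have m2 := MidR_last a1 a2 ha2 j i
  by_cases h1 : (i:ℕ) = 0 ∧ (j:ℕ) = a2
  · have g1 : ¬ Arrow' a1 a2 (.r i) (.r j) := by simp only [Arrow']; omega
    have g2 : ¬ Arrow' a1 a2 (.r j) (.r i) := by simp only [Arrow']; omega
    have p1 := m1.2 (by omega)
    have p2 := m2.2 (by omega)
    simp [g1, g2, p1, p2]
  by_cases h2 : (i:ℕ) = a2 ∧ (j:ℕ) = 0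
  · have g1 : ¬ Arrow' a1 a2 (.r i) (.r j) := by simp only [Arrow']; omega
    have g2 : ¬ Arrow' a1 a2 (.r j) (.r i) := by simp only [Arrow']; omega
    have p1 := m1.2 (by omega)
    have p2 := m2.2 (by omega)
    simp [g1, g2, p1, p2]
  have h1' : ¬ ((j:ℕ) = a2 ∧ (i:ℕ) = 0) := fun h => h1 h.symm
  have h2' : ¬ ((j:ℕ) = 0 ∧ (i:ℕ) = a2) := fun h => h2 h.symm
  simp only [h1, h2, h1', h2', or_false] at m1 m2
  rw [m1, m2]

lemma Mid_seq (a1 a2 k : ℕ) (h : k < a2) :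
    mutSeq ((List.range k).map (fun m => rv a1 a2 (m + 1))) (Bmat a1 a2) =
      BmatOf (Mid a1 a2 k) := by
  induction k with
  | zero => simp [mutSeq, Mid_zero]
  | succ k ih =>
    have := ih (by omega)
    rw [← Mid_step a1 a2 k h, ← this]
    simp [mutSeq, List.range_succ]

def ht18 (a1 a2 : ℕ) : V a1 a2 → ℕ
  | .s i => i
  | .r i => if (i:ℕ) = a2 then a1 else if (i:ℕ) = 0 then a1 + a2 + 2 else a1 + 1 + i
  | .t i => a1 + a2 + 3 + i

lemma ht18_lt (a1 a2 : ℕ) (ha1 : 0 < a1) (ha2 : 2 ≤ a2) (x y : V a1 a2)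
    (h : Arrow' a1 a2 x y) : ht18 a1 a2 x < ht18 a1 a2 y := by
  rcases x with i | i | i <;> rcases y with j | j | j <;> simp only [Arrow'] at h <;>
    simp only [ht18] <;> (try split_ifs) <;> omega

theorem statement18 (a1 a2 : ℕ) (ha1 : 0 < a1) (ha2 : 2 ≤ a2) :
    mutSeq (Rlist a1 a2) (Bmat a1 a2) = BmatOf (Arrow' a1 a2) ∧
    (∀ x : V a1 a2, ¬ Relation.TransGen (Arrow' a1 a2) x x) := by
  refine ⟨?_, ?_⟩
  · unfold Rlist
    rw [Mid_seq a1 a2 (a2-1) (by omega), Mid_last a1 a2 ha2]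
  · have H : ∀ x y, Relation.TransGen (Arrow' a1 a2) x y → ht18 a1 a2 x < ht18 a1 a2 y := by
      intro x y h
      induction h with
      | single h => exact ht18_lt a1 a2 ha1 ha2 _ _ h
      | tail _ h ih => exact ih.trans (ht18_lt a1 a2 ha1 ha2 _ _ h)
    intro x h
    exact lt_irrefl _ (H x x h)
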